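/- If a and b are even natural numbers, c is an odd natural number, and a < c, then Player 2 has a winning strategy in the (a,b,c)-game; that is, the state with a ones, b twos, and c threes is not a first-player win in the reversed Zeckendorf game. -/

import Mathlib

/-- The Fibonacci numbers indexed so that `zfib 1 = 1`, `zfib 2 = 2`,
and `zfib (i+1) = zfib i + zfib (i-1)`. -/
def zfib (i : ℕ) : ℕ := Nat.fib (i + 1)

/-- A game state: a finitely supported function recording the height of each bin.
Bin indices start at `1`; index `0` is unused. -/
abbrev ZState := ℕ →₀ ℕ

/-- The legal moves of the reversed Zeckendorf game. -/
inductive ZMove : ZState → ZState → Prop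
  | split (h : ZState) (i : ℕ) (hi : 2 ≤ i) (hpos : 0 < h (i + 1)) :
      ZMove h (h - Finsupp.single (i + 1) 1 + Finsupp.single i 1 + Finsupp.single (i - 1) 1)
  | splitTwo (h : ZState) (hpos : 0 < h 2) :
      ZMove h (h - Finsupp.single 2 1 + Finsupp.single 1 2)
  | combine (h : ZState) (i : ℕ) (hi : 2 < i) (h1 : 0 < h (i + 1)) (h2 : 0 < h (i - 2)) :
      ZMove h (h - Finsupp.single (i + 1) 1 - Finsupp.single (i - 2) 1 + Finsupp.single i 2)
  | combineTwo (h : ZState) (h1 : 0 < h 3) (h2 : 0 < h 1) :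
      ZMove h (h - Finsupp.single 3 1 - Finsupp.single 1 1 + Finsupp.single 2 2)

mutual
  /-- The state is a first-player win: some legal move leads to a state that is a
  loss for the player then to move. -/
  inductive ZFirstWin : ZState → Prop
    | intro (h h' : ZState) (m : ZMove h h') (hl : ZLoss h') : ZFirstWin h
  /-- The state is a loss for the player to move (i.e., not a first-player win):
  every legal move leads to a first-player win for the opponent. -/
  inductive ZLoss : ZState → Prop
    | intro (h : ZState) (hall : ∀ h', ZMove h h' → ZFirstWin h') : ZLoss h
end

/-- The starting state of the `(a,b,c)`-game: `a` ones, `b` twos and `c` threes. -/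
noncomputable def abcState (a b c : ℕ) : ZState :=
  Finsupp.single 1 a + Finsupp.single 2 b + Finsupp.single 3 c

def PPos (a b c : ℕ) : Prop :=
  b % 2 = 0 ∧ ((a < c ∧ a % 2 = 0) ∨ (c ≤ a ∧ c % 2 = 0))

theorem abc_apply (a b c i : ℕ) : abcState a b c i =
    (if i = 1 then a else 0) + (if i = 2 then b else 0) + (if i = 3 then c else 0) := by
  simp [abcState, Finsupp.single_apply, eq_comm]

theorem abc_A (a b c : ℕ) (hc : 0 < c) :
    abcState a b c - Finsupp.single 3 1 + Finsupp.single 2 1 + Finsupp.single 1 1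
      = abcState (a+1) (b+1) (c-1) := by
  ext j
  simp only [Finsupp.add_apply, Finsupp.tsub_apply, abc_apply, Finsupp.single_apply]
  split_ifs <;> omega

theorem abc_B (a b c : ℕ) :
    abcState a b c - Finsupp.single 2 1 + Finsupp.single 1 2 = abcState (a+2) (b-1) c := by
  ext j
  simp only [Finsupp.add_apply, Finsupp.tsub_apply, abc_apply, Finsupp.single_apply]
  split_ifs <;> omega

theorem abc_C (a b c : ℕ) :
    abcState a b c - Finsupp.single 3 1 - Finsupp.single 1 1 + Finsupp.single 2 2
      = abcState (a-1) (b+2) (c-1) := by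
  ext j
  simp only [Finsupp.add_apply, Finsupp.tsub_apply, abc_apply, Finsupp.single_apply]
  split_ifs <;> omega

theorem move_A (a b c : ℕ) (hc : 0 < c) :
    ZMove (abcState a b c) (abcState (a+1) (b+1) (c-1)) := by
  rw [← abc_A a b c hc]
  exact ZMove.split _ 2 le_rfl (by simpa [abc_apply] using hc)

theorem move_B (a b c : ℕ) (hb : 0 < b) :
    ZMove (abcState a b c) (abcState (a+2) (b-1) c) := by
  rw [← abc_B a b c]
  exact ZMove.splitTwo _ (by simpa [abc_apply] using hb)

theorem move_C (a b c : ℕ) (ha : 0 < a) (hc : 0 < c) :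
    ZMove (abcState a b c) (abcState (a-1) (b+2) (c-1)) := by
  rw [← abc_C a b c]
  exact ZMove.combineTwo _ (by simpa [abc_apply] using hc) (by simpa [abc_apply] using ha)

theorem move_cases {h h' : ZState} (m : ZMove h h') (a b c : ℕ) (e : h = abcState a b c) :
    (0 < c ∧ h' = abcState (a+1) (b+1) (c-1)) ∨ (0 < b ∧ h' = abcState (a+2) (b-1) c) ∨
    (0 < a ∧ 0 < c ∧ h' = abcState (a-1) (b+2) (c-1)) := by
  subst e
  cases m with
  | split i hi hpos =>
    have : i = 2 := by
      rw [abc_apply] at hpos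
      split_ifs at hpos <;> omega
    subst this
    have hc : 0 < c := by simpa [abc_apply] using hpos
    exact Or.inl ⟨hc, abc_A a b c hc⟩
  | splitTwo hpos =>
    exact Or.inr (Or.inl ⟨by simpa [abc_apply] using hpos, abc_B a b c⟩)
  | combine i hi h1 h2 =>
    rw [abc_apply] at h1
    split_ifs at h1 <;> omega
  | combineTwo h1 h2 =>
    exact Or.inr (Or.inr ⟨by simpa [abc_apply] using h2, by simpa [abc_apply] using h1,
      abc_C a b c⟩)

mutual
theorem firstWin_not {h : ZState} (w : ZFirstWin h) (a b c : ℕ) (e : h = abcState a b c) :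
    ¬ PPos a b c := by
  match w with
  | .intro _ h' m hl =>
    intro hp
    rcases move_cases m a b c e with ⟨h1, e'⟩ | ⟨h1, e'⟩ | ⟨h1, h2, e'⟩
    all_goals
      have := loss_pos hl _ _ _ e'
      unfold PPos at *
      omega
theorem loss_pos {h : ZState} (w : ZLoss h) (a b c : ℕ) (e : h = abcState a b c) :
    PPos a b c := by
  match w with
  | .intro _ hall =>
    have key : ∀ a' b' c', ZMove (abcState a b c) (abcState a' b' c') → ¬ PPos a' b' c' :=
      fun a' b' c' m => firstWin_not (hall (abcState a' b' c') (e ▸ m)) a' b' c' rfl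
    have kA := fun hc => key _ _ _ (move_A a b c hc)
    have kB := fun hb => key _ _ _ (move_B a b c hb)
    have kC := fun ha hc => key _ _ _ (move_C a b c ha hc)
    clear key
    unfold PPos at *
    by_cases ha : 0 < a <;> by_cases hb : 0 < b <;> by_cases hc : 0 < c <;>
      simp only [ha, hb, hc, forall_const, true_implies, false_implies] at kA kB kC <;> omega
end

theorem abcGame_even_even_odd_lt_not_firstPlayerWin (a b c : ℕ) (ha : Even a) (hb : Even b) (hc : Odd c) (hac : a < c) :
    ¬ ZFirstWin (abcState a b c) := by
  intro w
  refine firstWin_not w a b c rfl ?_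
  rw [Nat.even_iff] at ha hb
  exact ⟨hb, Or.inl ⟨hac, ha⟩⟩
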